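/- Let Δ be an M,N-invariant set with 0 ∈ Δ. Then M ∈ Δ, N ∈ Δ, and M+N ∈ Δ; consequently area(dec(Δ)) = area(Δ), and pdinv(dec(Δ)) = pdinv(Δ). -/

import Mathlib

/-- The alphabet {0, 1, •}. -/
inductive Symb where
  | zero : Symb
  | one : Symb
  | bullet : Symb
deriving DecidableEq

/-- An `M,N`-invariant set: a subset of ℕ with finite complement,
closed under adding `M` and adding `N`. -/
def Invariant (M N : ℕ) (Δ : Set ℕ) : Prop :=
  {n : ℕ | n ∉ Δ}.Finite ∧ ∀ i ∈ Δ, i + M ∈ Δ ∧ i + N ∈ Δ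

/-- `c` is a north step of `Δ`: `c ∉ Δ` and `c + N ∈ Δ`. -/
def NorthStep (N : ℕ) (Δ : Set ℕ) (c : ℕ) : Prop := c ∉ Δ ∧ c + N ∈ Δ

/-- `c` is an east step of `Δ`: `c ∉ Δ` and `c + M ∈ Δ`. -/
def EastStep (M : ℕ) (Δ : Set ℕ) (c : ℕ) : Prop := c ∉ Δ ∧ c + M ∈ Δ

/-- `area Δ` is the number of `c ≥ M + N` with `c ∉ Δ`. -/
noncomputable def area (M N : ℕ) (Δ : Set ℕ) : ℕ := {c : ℕ | M + N ≤ c ∧ c ∉ Δ}.ncard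

/-- `pdinv Δ` is the number of pairs `(c, d)` with `c < d`, `M ≤ d < c + M`,
`c` a north step of `Δ`, and `d ∉ Δ`. -/
noncomputable def pdinv (M N : ℕ) (Δ : Set ℕ) : ℕ :=
  {p : ℕ × ℕ | p.1 < p.2 ∧ M ≤ p.2 ∧ p.2 < p.1 + M ∧ NorthStep N Δ p.1 ∧ p.2 ∉ Δ}.ncard

/-- `Δ` fits the pair of words `(v, w)`, where `v` has length `M` and `w` has length `N`. -/
def Fits (M N : ℕ) (Δ : Set ℕ) (v w : List Symb) : Prop :=
  v.length = M ∧ w.length = N ∧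
  (∀ (i : ℕ) (hi : i < v.length),
    (v.get ⟨i, hi⟩ = Symb.bullet ↔ i ∈ Δ) ∧
    (v.get ⟨i, hi⟩ = Symb.one ↔ NorthStep N Δ i) ∧
    (v.get ⟨i, hi⟩ = Symb.zero ↔ (i ∉ Δ ∧ i + N ∉ Δ))) ∧
  (∀ (i : ℕ) (hi : i < w.length),
    (w.get ⟨i, hi⟩ = Symb.bullet ↔ i ∈ Δ) ∧
    (w.get ⟨i, hi⟩ = Symb.one ↔ EastStep M Δ i) ∧
    (w.get ⟨i, hi⟩ = Symb.zero ↔ (i ∉ Δ ∧ i + M ∉ Δ)))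

/-- Decrement: `dec Δ = {i : ℕ | i + 1 ∈ Δ}`. -/
def dec (Δ : Set ℕ) : Set ℕ := {i : ℕ | i + 1 ∈ Δ}

theorem area_dec (M N : ℕ) (Δ : Set ℕ) (h : M + N ∈ Δ) :
    area M N (dec Δ) = area M N Δ := by
  unfold area
  rw [← Set.ncard_image_of_injective _ Nat.succ_injective]
  congr 1
  ext c
  constructor
  · rintro ⟨c, ⟨hc, hcΔ⟩, rfl⟩
    exact ⟨Nat.le_succ_of_le hc, hcΔ⟩
  · rintro ⟨hc, hcΔ⟩
    have hne : c ≠ M + N := fun e => hcΔ (e ▸ h)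
    obtain ⟨c, rfl⟩ : ∃ k, c = k + 1 := ⟨c - 1, by omega⟩
    exact ⟨c, ⟨by omega, hcΔ⟩, rfl⟩

theorem northStep_dec (N : ℕ) (Δ : Set ℕ) (c : ℕ) :
    NorthStep N (dec Δ) c ↔ NorthStep N Δ (c + 1) := by
  simp only [NorthStep, dec, Set.mem_ofPred_eq, Nat.add_right_comm]

theorem pdinv_dec (M N : ℕ) (Δ : Set ℕ) (h0 : 0 ∈ Δ) (h : M ∈ Δ) :
    pdinv M N (dec Δ) = pdinv M N Δ := by
  unfold pdinv
  rw [← Set.ncard_image_of_injective _ (Nat.succ_injective.prodMap Nat.succ_injective)]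
  congr 1
  ext ⟨c, d⟩
  constructor
  · rintro ⟨⟨c, d⟩, ⟨hcd, hMd, hdM, hc, hd⟩, he⟩
    obtain ⟨rfl, rfl⟩ := Prod.mk.inj he
    dsimp only at hcd hMd hdM hc hd
    exact ⟨by dsimp only; omega, by dsimp only; omega, by dsimp only; omega,
      (northStep_dec N Δ c).1 hc, hd⟩
  · rintro ⟨hcd, hMd, hdM, hc, hd⟩
    dsimp only at hcd hMd hdM hc hd
    have hc0 : c ≠ 0 := fun e => hc.1 (e ▸ h0)
    have hdne : d ≠ M := fun e => hd (e ▸ h)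
    obtain ⟨c, rfl⟩ : ∃ k, c = k + 1 := ⟨c - 1, by omega⟩
    obtain ⟨d, rfl⟩ : ∃ k, d = k + 1 := ⟨d - 1, by omega⟩
    exact ⟨(c, d), ⟨by dsimp only; omega, by dsimp only; omega, by dsimp only; omega,
      (northStep_dec N Δ c).2 hc, hd⟩, rfl⟩

/-- If `Δ` is an `M,N`-invariant set with `0 ∈ Δ`, then `M ∈ Δ`,
`N ∈ Δ`, and `M + N ∈ Δ`; consequently `area (dec Δ) = area Δ` and
`pdinv (dec Δ) = pdinv Δ`. -/
theorem dec_stats_zero_mem (M N : ℕ) (hM : 0 < M) (hN : 0 < N)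
    (Δ : Set ℕ) (hΔ : Invariant M N Δ) (h0 : 0 ∈ Δ) :
    M ∈ Δ ∧ N ∈ Δ ∧ M + N ∈ Δ ∧
    area M N (dec Δ) = area M N Δ ∧ pdinv M N (dec Δ) = pdinv M N Δ := by
  have hM' : M ∈ Δ := by simpa using (hΔ.2 0 h0).1
  have hN' : N ∈ Δ := by simpa using (hΔ.2 0 h0).2
  have hMN : M + N ∈ Δ := (hΔ.2 M hM').2
  exact ⟨hM', hN', hMN, area_dec M N Δ hMN, pdinv_dec M N Δ h0 hM'⟩
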